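/- arXiv:1109.5683 — 2 statements merged into one kernel-verified Lean document; each statement's English description precedes it below -/
import Mathlib

section
/- Fix an integer k ≥ 2 and a real b with 0 < b < 1. For each n, let δ : [n] × [k] → [n] be a uniformly random k-map (all n^{kn} functions equally likely) and independently draw T ⊆ [n] with the Bernoulli measure μ_b; say p ∼ q if for every word u ∈ [k]*, δ(p, u) ∈ T ↔ δ(q, u) ∈ T. The probability that δ contains no M-motif and yet there exist two distinct states i ∼ j is o(n^{3/2-k}) as n → ∞. -/
open scoped Classical BigOperators

namespace ArxivAutomata

/-- Extension of a transition structure to words: `run δ p u = δ(p, u)`. -/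
def run {n k : ℕ} (δ : Fin n → Fin k → Fin n) (p : Fin n) (u : List (Fin k)) : Fin n :=
  u.foldl δ p

/-- A transition structure is accessible if every state is reachable from the
initial state (the state with index 0, representing state 1). -/
def Accessible {n k : ℕ} (δ : Fin n → Fin k → Fin n) : Prop :=
  ∀ q : Fin n, ∃ u : List (Fin k), run δ ⟨0, Fin.pos q⟩ u = q

/-- The finite set of accessible transition structures on `n` states over a
`k`-letter alphabet. -/
noncomputable def accSet (n k : ℕ) : Finset (Fin n → Fin k → Fin n) :=
  Finset.univ.filter fun δ => Accessible δ

/-- Myhill–Nerode equivalence of two states. -/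
def MNEquiv {n k : ℕ} (δ : Fin n → Fin k → Fin n) (T : Finset (Fin n)) (p q : Fin n) : Prop :=
  ∀ u : List (Fin k), run δ p u ∈ T ↔ run δ q u ∈ T

/-- An automaton is minimal if Myhill–Nerode equivalent states are equal. -/
def Minimal {n k : ℕ} (δ : Fin n → Fin k → Fin n) (T : Finset (Fin n)) : Prop :=
  ∀ p q : Fin n, MNEquiv δ T p q → p = q

/-- `{i, j}` is an M-motif: `i ≠ j` and `δ_a(i) = δ_a(j)` for every letter `a`. -/
def IsMMotif {n k : ℕ} (δ : Fin n → Fin k → Fin n) (i j : Fin n) : Prop :=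
  i ≠ j ∧ ∀ a : Fin k, δ i a = δ j a

/-- `{i, j, h}` is a three-state M-motif. -/
def IsM3Motif {n k : ℕ} (δ : Fin n → Fin k → Fin n) (i j h : Fin n) : Prop :=
  i ≠ j ∧ i ≠ h ∧ j ≠ h ∧ ∀ a : Fin k, δ i a = δ j a ∧ δ j a = δ h a

/-- `δ` contains some three-state M-motif. -/
def HasM3 {n k : ℕ} (δ : Fin n → Fin k → Fin n) : Prop :=
  ∃ i j h, IsM3Motif δ i j h

/-- The number of M-motifs of `δ` (unordered pairs counted via `i < j`). -/
noncomputable def mCount {n k : ℕ} (δ : Fin n → Fin k → Fin n) : ℕ :=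
  (Finset.univ.filter fun p : Fin n × Fin n =>
    p.1 < p.2 ∧ ∀ a : Fin k, δ p.1 a = δ p.2 a).card

/-- The number of three-state M-motifs of `δ` (unordered triples via `i < j < h`). -/
noncomputable def m3Count {n k : ℕ} (δ : Fin n → Fin k → Fin n) : ℕ :=
  (Finset.univ.filter fun p : Fin n × Fin n × Fin n =>
    p.1 < p.2.1 ∧ p.2.1 < p.2.2 ∧
      ∀ a : Fin k, δ p.1 a = δ p.2.1 a ∧ δ p.2.1 a = δ p.2.2 a).card

/-- The Bernoulli measure of parameter `b` of a set of terminal states. -/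
noncomputable def bern (b : ℝ) {n : ℕ} (T : Finset (Fin n)) : ℝ :=
  b ^ T.card * (1 - b) ^ (n - T.card)


/-- The points that `f` does not fix. -/
noncomputable def moved {n : ℕ} (f : Fin n → Fin n) : Finset (Fin n) :=
  Finset.univ.filter fun x => f x ≠ x

/-- The images of the points that `f` does not fix. -/
noncomputable def reps {n : ℕ} (f : Fin n → Fin n) : Finset (Fin n) :=
  (moved f).image f

/-- `f` selects representatives in such a way that `δ` is compatible with `f` up to moved points,
and every representative of a moved point has a successor that is moved or represents a moved
point. -/
def Collapses {n k : ℕ} (f : Fin n → Fin n) (δ : Fin n → Fin k → Fin n) : Prop :=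
  (∀ x ∈ moved f, ∀ a, δ x a ∈ moved f ∨ δ x a = f (δ (f x) a)) ∧
    ∀ y ∈ reps f, ∃ a, δ y a ∈ moved f ∪ reps f

theorem mem_moved {n : ℕ} {f : Fin n → Fin n} {x : Fin n} : x ∈ moved f ↔ f x ≠ x := by
  simp [moved]

/-- Representatives for the congruence generated by a pair of states. -/
theorem exists_representatives {n k : ℕ} (δ : Fin n → Fin k → Fin n) (i j : Fin n) :
    ∃ f : Fin n → Fin n, (∀ x, f (f x) = f x) ∧ f i = f j ∧
      (∀ x y a, f x = f y → f (δ x a) = f (δ y a)) ∧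
      ∀ T, MNEquiv δ T i j → ∀ x, x ∈ T ↔ f x ∈ T := by
  let C : Set (Setoid (Fin n)) :=
    {s | s i j ∧ ∀ x y a, s x y → s (δ x a) (δ y a)}
  let s : Setoid (Fin n) := sInf C
  have hs : ∀ x y, s x y ↔ ∀ r ∈ C, r x y := fun x y => Iff.rfl
  let f : Fin n → Fin n := fun x => (Quotient.mk s x).out
  have hfx : ∀ x, s (f x) x := fun x => Quotient.mk_out (s := s) x
  have hf : ∀ x y, f x = f y ↔ s x y := by
    intro x y
    constructor
    · intro h
      have h1 := hfx x
      rw [h] at h1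
      exact s.trans (s.symm h1) (hfx y)
    · intro h
      have : Quotient.mk s x = Quotient.mk s y := Quotient.sound h
      simp only [f, this]
  refine ⟨f, fun x => (hf _ _).2 (hfx x), (hf _ _).2 ((hs _ _).2 fun r hr => hr.1), ?_, ?_⟩
  · intro x y a h
    rw [hf, hs] at *
    exact fun r hr => hr.2 x y a (h r hr)
  · intro T hT x
    let r : Setoid (Fin n) :=
      ⟨MNEquiv δ T, fun _ _ => Iff.rfl, fun h u => (h u).symm, fun h h' u => (h u).trans (h' u)⟩
    have hr : r ∈ C := ⟨hT, fun x y a h u => h (a :: u)⟩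
    exact ((hs _ _).1 (hfx x) r hr []).symm

theorem collapses_of_congruence {n k : ℕ} {f : Fin n → Fin n} {δ : Fin n → Fin k → Fin n}
    (hf : ∀ x, f (f x) = f x) (hc : ∀ x y a, f x = f y → f (δ x a) = f (δ y a))
    (hM : ¬ ∃ i j : Fin n, IsMMotif δ i j) : Collapses f δ := by
  constructor
  · intro x _ a
    by_cases h : δ x a ∈ moved f
    · exact Or.inl h
    · rw [mem_moved, not_not] at h
      exact Or.inr (by rw [hc (f x) x a (hf x), h])
  · intro y hy
    obtain ⟨x, hx, rfl⟩ := Finset.mem_image.1 hy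
    rw [mem_moved] at hx
    by_contra! H
    refine hM ⟨f x, x, hx, fun a => ?_⟩
    have h1 := H a
    rw [Finset.mem_union, not_or] at h1
    have h2 : f (δ (f x) a) = δ (f x) a := by
      by_contra h; exact h1.1 (mem_moved.2 h)
    have h3 := hc (f x) x a (hf x)
    by_contra h4
    refine h1.2 (Finset.mem_image.2 ⟨δ x a, mem_moved.2 ?_, by rw [← h3, h2]⟩)
    rw [← h3, h2]
    exact h4

theorem card_exists_mem_le {n k : ℕ} (S : Finset (Fin n)) :
    (Finset.univ.filter fun g : Fin k → Fin n => ∃ a, g a ∈ S).card ≤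
      k * (S.card * n ^ (k - 1)) := by
  have hsub : (Finset.univ.filter fun g : Fin k → Fin n => ∃ a, g a ∈ S) ⊆
      Finset.univ.biUnion fun a : Fin k =>
        Fintype.piFinset (Function.update (fun _ => Finset.univ) a S) := by
    intro g hg
    obtain ⟨a, ha⟩ := (Finset.mem_filter.1 hg).2
    refine Finset.mem_biUnion.2 ⟨a, Finset.mem_univ _, Fintype.mem_piFinset.2 fun c => ?_⟩
    by_cases h : c = a
    · subst h; simpa using ha
    · simp [Function.update_of_ne h]
  refine (Finset.card_le_card hsub).trans (Finset.card_biUnion_le.trans ?_)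
  refine (Finset.sum_le_card_nsmul _ _ (S.card * n ^ (k - 1)) fun a _ => ?_).trans (by simp)
  rw [Fintype.card_piFinset]
  have : ∀ c, (Function.update (fun _ : Fin k => (Finset.univ : Finset (Fin n))) a S c).card =
      Function.update (fun _ => n) a S.card c := by
    intro c
    by_cases h : c = a
    · subst h; simp
    · simp [Function.update_of_ne h]
  simp only [this]
  rw [Finset.prod_update_of_mem (Finset.mem_univ a)]
  simp [Finset.card_sdiff]

theorem prod_three_cases {n : ℕ} {A Y : Finset (Fin n)} (h : Disjoint A Y) (u v w : ℕ) :
    ∏ p : Fin n, (if p ∈ A then u else if p ∈ Y then v else w) =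
      u ^ A.card * v ^ Y.card * w ^ (n - A.card - Y.card) := by
  have hY : (Finset.univ.filter fun p => p ∉ A).filter (fun p => p ∈ Y) = Y := by
    ext p
    simp only [Finset.mem_filter, Finset.mem_univ, true_and, and_iff_right_iff_imp]
    exact fun hp hA => Finset.disjoint_left.1 h hA hp
  have hN : ((Finset.univ.filter fun p => p ∉ A).filter (fun p => p ∉ Y)).card =
      n - A.card - Y.card := by
    rw [Finset.filter_filter]
    have : (Finset.univ.filter fun p => p ∉ A ∧ p ∉ Y) = (A ∪ Y)ᶜ := by
      ext p; simp
    rw [this, Finset.card_compl, Finset.card_union_of_disjoint h, Fintype.card_fin]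
    omega
  rw [Finset.prod_ite, Finset.prod_ite, hY]
  simp only [Finset.prod_const, hN]
  simp [mul_assoc]

theorem disjoint_moved_reps {n : ℕ} {f : Fin n → Fin n} (hf : ∀ x, f (f x) = f x) :
    Disjoint (moved f) (reps f) := by
  refine Finset.disjoint_left.2 fun y hy hy' => ?_
  obtain ⟨x, _, rfl⟩ := Finset.mem_image.1 hy'
  exact mem_moved.1 hy (hf x)

theorem card_collapses_le {n k : ℕ} {f : Fin n → Fin n} (hf : ∀ x, f (f x) = f x) :
    (Finset.univ.filter fun δ : Fin n → Fin k → Fin n => Collapses f δ).card ≤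
      (((moved f).card + 1) ^ k) ^ (moved f).card *
        (k * (((moved f).card + (reps f).card) * n ^ (k - 1))) ^ (reps f).card *
        (n ^ k) ^ (n - (moved f).card - (reps f).card) := by
  set A := moved f with hA
  set Y := reps f with hY
  let B : Fin n → Finset (Fin k → Fin n) := fun p =>
    if p ∈ A then Fintype.piFinset fun _ => insert (f p) A
    else if p ∈ Y then Finset.univ.filter fun g => ∃ a, g a ∈ A ∪ Y
    else Finset.univ
  let code : (Fin n → Fin k → Fin n) → Fin n → Fin k → Fin n := fun δ p a =>
    if p ∈ A then (if δ p a ∈ A then δ p a else f p) else δ p a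
  have hfA : ∀ p, f p ∉ A := fun p hp => mem_moved.1 hp (hf p)
  have hle : (Finset.univ.filter fun δ : Fin n → Fin k → Fin n => Collapses f δ).card ≤
      (Fintype.piFinset B).card := by
    refine Finset.card_le_card_of_injOn code ?_ ?_
    · intro δ hδ
      have hδ' : Collapses f δ := by simpa using hδ
      rw [Finset.mem_coe, Fintype.mem_piFinset]
      intro p
      by_cases hp : p ∈ A
      · simp only [B, code, hp, if_true, Fintype.mem_piFinset]
        intro a
        split_ifs with h <;> simp [h]
      · by_cases hp' : p ∈ Y
        · simp only [B, code, hp, hp', if_true, if_false, Finset.mem_filter, Finset.mem_univ,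
            true_and]
          exact hδ'.2 p hp'
        · simp [B, hp, hp']
    · intro δ hδ δ' hδ' h
      have hδ : Collapses f δ := by simpa using hδ
      have hδ' : Collapses f δ' := by simpa using hδ'
      have hpa : ∀ p a, code δ p a = code δ' p a := fun p a => by rw [h]
      have hout : ∀ p, p ∉ A → ∀ a, δ p a = δ' p a := by
        intro p hp a
        simpa [code, hp] using hpa p a
      funext p a
      by_cases hp : p ∈ A
      · have h1 := hpa p a
        simp only [code, hp, if_true] at h1
        split_ifs at h1 with h2 h3 h3
        · exact h1
        · exact absurd (h1 ▸ h2) (hfA p)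
        · exact absurd (h1 ▸ h3) (hfA p)
        · rw [(hδ.1 p hp a).resolve_left h2, (hδ'.1 p hp a).resolve_left h3, hout _ (hfA p)]
      · exact hout p hp a
  refine hle.trans ?_
  rw [Fintype.card_piFinset, ← prod_three_cases (disjoint_moved_reps hf)]
  refine Finset.prod_le_prod' fun p _ => ?_
  simp only [B]
  rw [← hA, ← hY]
  split_ifs with h1 h2
  · rw [Fintype.card_piFinset_const]
    exact Nat.pow_le_pow_left (Finset.card_insert_le _ _) _
  · refine (card_exists_mem_le _).trans ?_
    gcongr
    exact Finset.card_union_le _ _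
  · simp

theorem card_representatives_le (n r c : ℕ) :
    (Finset.univ.filter fun f : Fin n → Fin n =>
      (moved f).card = r ∧ (reps f).card = c).card ≤ n ^ r * (n ^ c * c ^ r) := by
  have hsub : (Finset.univ.filter fun f : Fin n → Fin n =>
      (moved f).card = r ∧ (reps f).card = c) ⊆
      (Finset.powersetCard r Finset.univ).biUnion fun A =>
        (Finset.powersetCard c Finset.univ).biUnion fun Y =>
          Fintype.piFinset fun p => if p ∈ A then Y else {p} := by
    intro f hf
    obtain ⟨h1, h2⟩ := (Finset.mem_filter.1 hf).2
    refine Finset.mem_biUnion.2 ⟨moved f, by simp [Finset.mem_powersetCard, h1], ?_⟩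
    refine Finset.mem_biUnion.2 ⟨reps f, by simp [Finset.mem_powersetCard, h2], ?_⟩
    refine Fintype.mem_piFinset.2 fun p => ?_
    split_ifs with hp
    · exact Finset.mem_image_of_mem f hp
    · rw [mem_moved, not_not] at hp
      simp [hp]
  refine (Finset.card_le_card hsub).trans ?_
  refine (Finset.card_biUnion_le_card_mul _ _ (n ^ c * c ^ r) fun A hA => ?_).trans ?_
  · refine (Finset.card_biUnion_le_card_mul _ _ (c ^ r) fun Y hY => ?_).trans ?_
    · rw [Finset.mem_powersetCard] at hA hY
      rw [Fintype.card_piFinset]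
      have : ∀ p, (if p ∈ A then Y else {p}).card = if p ∈ A then c else 1 := by
        intro p; split_ifs <;> simp [hY.2]
      simp [this, hA.2]
    · gcongr
      simpa using Nat.choose_le_pow n c
  · gcongr
    simpa using Nat.choose_le_pow n r

theorem card_biUnion_collapses_mul_le {n k R r c : ℕ} (hk : 1 ≤ k) (hr : r ≤ R) :
    ((Finset.univ.filter fun f : Fin n → Fin n =>
        (∀ x, f (f x) = f x) ∧ (moved f).card = r ∧ (reps f).card = c).biUnion fun f =>
      Finset.univ.filter fun δ : Fin n → Fin k → Fin n => Collapses f δ).card *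
        n ^ ((k - 1) * r) ≤ n ^ (k * n) * (2 * k * (R + 1) ^ (k + 2)) ^ r := by
  set F := Finset.univ.filter fun f : Fin n → Fin n =>
    (∀ x, f (f x) = f x) ∧ (moved f).card = r ∧ (reps f).card = c with hF
  rcases F.eq_empty_or_nonempty with h | ⟨f₀, hf₀⟩
  · simp [h]
  have hF' : F.card ≤ n ^ r * (n ^ c * c ^ r) := by
    refine (Finset.card_le_card fun f hf => ?_).trans (card_representatives_le n r c)
    simp only [hF, Finset.mem_filter, Finset.mem_univ, true_and] at hf ⊢
    exact hf.2
  obtain ⟨hid, hmr, hrc⟩ := (Finset.mem_filter.1 hf₀).2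
  have hcr : c ≤ r := by rw [← hmr, ← hrc]; exact Finset.card_image_le
  have hn : r + c ≤ n := by
    rw [← hmr, ← hrc, ← Finset.card_union_of_disjoint (disjoint_moved_reps hid)]
    exact (Finset.card_le_univ _).trans (by simp)
  have hbi := Finset.card_biUnion_le_card_mul F
    (fun f => Finset.univ.filter fun δ : Fin n → Fin k → Fin n => Collapses f δ)
    (((r + 1) ^ k) ^ r * (k * ((r + c) * n ^ (k - 1))) ^ c * (n ^ k) ^ (n - r - c))
    (fun f hf => by
      obtain ⟨h1, h2, h3⟩ := (Finset.mem_filter.1 hf).2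
      have := card_collapses_le (k := k) h1
      rwa [h2, h3] at this)
  obtain ⟨l, rfl⟩ : ∃ l, k = l + 1 := ⟨k - 1, by omega⟩
  obtain ⟨d, hd⟩ : ∃ d, n - r - c = d := ⟨_, rfl⟩
  rw [hd, Nat.add_sub_cancel] at hbi
  rw [Nat.add_sub_cancel]
  have hbase : 1 ≤ 2 * (l + 1) * (R + 1) := Nat.one_le_iff_ne_zero.2 (by positivity)
  calc _ ≤ (n ^ r * (n ^ c * c ^ r)) * (((r + 1) ^ (l + 1)) ^ r *
        ((l + 1) * ((r + c) * n ^ l)) ^ c * (n ^ (l + 1)) ^ d) * n ^ (l * r) := by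
        gcongr
        exact hbi.trans (Nat.mul_le_mul_right _ hF')
    _ = n ^ ((l + 1) * n) * (c ^ r * ((r + 1) ^ (l + 1)) ^ r * ((l + 1) * (r + c)) ^ c) := by
        rw [show (l + 1) * n = r + c + l * c + (l + 1) * d + l * r by
          rw [show n = r + c + d by omega]; ring]
        rw [← mul_assoc (l + 1), mul_pow _ (n ^ l)]
        simp only [pow_add, ← pow_mul]
        ring
    _ ≤ n ^ ((l + 1) * n) *
        ((R + 1) ^ r * ((R + 1) ^ (l + 1)) ^ r * (2 * (l + 1) * (R + 1)) ^ r) := by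
        refine Nat.mul_le_mul_left _ (Nat.mul_le_mul (Nat.mul_le_mul ?_ ?_) ?_)
        · gcongr; omega
        · gcongr
        · refine (Nat.pow_le_pow_left ?_ c).trans (Nat.pow_le_pow_right hbase hcr)
          calc (l + 1) * (r + c) ≤ (l + 1) * (2 * (R + 1)) := by gcongr; omega
            _ = _ := by ring
    _ = _ := by
        rw [← mul_pow, ← mul_pow]
        ring

/-- First moment bound on the proportion of transition structures that collapse along
representatives moving between one and `R` points. -/
theorem card_small_collapse_le {n k : ℕ} (hk : 1 ≤ k) (hn : 0 < n) (R : ℕ) :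
    ((Finset.univ.filter fun δ : Fin n → Fin k → Fin n =>
        ∃ f : Fin n → Fin n, (∀ x, f (f x) = f x) ∧ (moved f).Nonempty ∧ (moved f).card ≤ R ∧
          Collapses f δ).card : ℝ) ≤
      (n : ℝ) ^ (k * n) * (2 * k * (R + 1) ^ (k + 4) / n ^ (k - 1)) := by
  set B := Finset.univ.filter fun δ : Fin n → Fin k → Fin n =>
    ∃ f : Fin n → Fin n, (∀ x, f (f x) = f x) ∧ (moved f).Nonempty ∧ (moved f).card ≤ R ∧
      Collapses f δ with hB
  have hn' : (0 : ℝ) < n := by exact_mod_cast hn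
  set q : ℝ := 2 * k * (R + 1) ^ (k + 2) / n ^ (k - 1) with hq
  have hq0 : 0 ≤ q := by positivity
  have hgoal : (2 * k * (R + 1) ^ (k + 4) / n ^ (k - 1) : ℝ) = (R + 1) ^ 2 * q := by
    rw [hq]; ring
  rw [hgoal]
  rcases le_total q 1 with hq1 | hq1
  · let G : ℕ × ℕ → Finset (Fin n → Fin k → Fin n) := fun t =>
      (Finset.univ.filter fun f : Fin n → Fin n =>
        (∀ x, f (f x) = f x) ∧ (moved f).card = t.1 ∧ (reps f).card = t.2).biUnion fun f =>
      Finset.univ.filter fun δ : Fin n → Fin k → Fin n => Collapses f δ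
    have hsub : B ⊆ (Finset.Icc 1 R ×ˢ Finset.range (R + 1)).biUnion G := by
      intro δ hδ
      obtain ⟨f, h1, h2, h3, h4⟩ := (Finset.mem_filter.1 hδ).2
      refine Finset.mem_biUnion.2 ⟨((moved f).card, (reps f).card), ?_, ?_⟩
      · have : (reps f).card ≤ (moved f).card := Finset.card_image_le
        have := h2.card_pos
        simp only [Finset.mem_product, Finset.mem_Icc, Finset.mem_range]
        omega
      · refine Finset.mem_biUnion.2 ⟨f, ?_, ?_⟩
        · simpa using h1
        · simpa using h4
    have hG : ∀ t ∈ Finset.Icc 1 R ×ˢ Finset.range (R + 1),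
        ((G t).card : ℝ) ≤ (n : ℝ) ^ (k * n) * q := by
      intro t ht
      simp only [Finset.mem_product, Finset.mem_Icc] at ht
      have h := card_biUnion_collapses_mul_le (n := n) (k := k) (c := t.2) hk ht.1.2
      have h' : ((G t).card : ℝ) * (n : ℝ) ^ ((k - 1) * t.1) ≤
          (n : ℝ) ^ (k * n) * (2 * k * (R + 1) ^ (k + 2)) ^ t.1 := by exact_mod_cast h
      rw [pow_mul, ← le_div_iff₀ (by positivity), mul_div_assoc, ← div_pow] at h'
      refine h'.trans ?_
      gcongr
      exact pow_le_of_le_one hq0 hq1 (by omega)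
    calc (B.card : ℝ) ≤ ∑ t ∈ Finset.Icc 1 R ×ˢ Finset.range (R + 1), ((G t).card : ℝ) := by
          exact_mod_cast (Finset.card_le_card hsub).trans Finset.card_biUnion_le
      _ ≤ (R * (R + 1) : ℝ) * ((n : ℝ) ^ (k * n) * q) := by
          refine (Finset.sum_le_card_nsmul _ _ _ hG).trans (le_of_eq ?_)
          simp
      _ ≤ ((R + 1) * (R + 1) : ℝ) * ((n : ℝ) ^ (k * n) * q) := by
          gcongr
          linarith
      _ = _ := by ring
  · have h1 : (B.card : ℝ) ≤ (n : ℝ) ^ (k * n) := by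
      have : B.card ≤ n ^ (k * n) := (Finset.card_le_univ _).trans (by simp [pow_mul])
      exact_mod_cast this
    refine h1.trans (le_mul_of_one_le_right (by positivity) ?_)
    have : (1 : ℝ) ≤ (R + 1) ^ 2 := one_le_pow₀ (by linarith [(Nat.cast_nonneg R : (0 : ℝ) ≤ R)])
    nlinarith

theorem bern_nonneg {b : ℝ} (hb : 0 < b) (hb1 : b < 1) {n : ℕ} (T : Finset (Fin n)) :
    0 ≤ bern b T :=
  mul_nonneg (pow_nonneg hb.le _) (pow_nonneg (by linarith) _)

theorem sum_bern (b : ℝ) (n : ℕ) : ∑ T : Finset (Fin n), bern b T = 1 := by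
  have := Fintype.sum_pow_mul_eq_add_pow (Fin n) b (1 - b)
  simpa [bern] using this

theorem sum_bern_saturated_le {b : ℝ} (hb : 0 < b) (hb1 : b < 1) {n : ℕ} {f : Fin n → Fin n}
    (hf : ∀ x, f (f x) = f x) :
    ∑ T ∈ Finset.univ.filter (fun T : Finset (Fin n) => ∀ x, x ∈ T ↔ f x ∈ T), bern b T ≤
      max b (1 - b) ^ (moved f).card := by
  set A := moved f with hA
  set m := max b (1 - b)
  have hb0 : 0 ≤ 1 - b := by linarith
  have hm : 0 ≤ m := hb.le.trans (le_max_left _ _)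
  have hfA : ∀ p, f p ∉ A := fun p hp => mem_moved.1 hp (hf p)
  let w : Finset (Fin n) → ℝ := fun U => b ^ U.card * (1 - b) ^ (Aᶜ.card - U.card)
  have hw : ∀ U, 0 ≤ w U := fun U => by positivity
  have hle : ∀ T : Finset (Fin n), bern b T ≤ m ^ A.card * w (T \ A) := by
    intro T
    have h1 := Finset.card_sdiff_add_card_inter T A
    have h2 : (A ∩ T).card ≤ A.card := Finset.card_le_card Finset.inter_subset_left
    have h3 : (T \ A).card ≤ Aᶜ.card := Finset.card_le_card fun x hx => by
      simpa using (Finset.mem_sdiff.1 hx).2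
    have h4 : Aᶜ.card + A.card = n := by rw [add_comm, Finset.card_add_card_compl]; simp
    rw [Finset.inter_comm] at h2
    have e1 : n - T.card = (A.card - (T ∩ A).card) + (Aᶜ.card - (T \ A).card) := by omega
    have e2 : m ^ A.card = m ^ (T ∩ A).card * m ^ (A.card - (T ∩ A).card) := by
      rw [← pow_add]; congr 1; omega
    simp only [bern, w]
    rw [← h1, h1, e1, e2, ← h1, pow_add, pow_add]
    calc b ^ (T \ A).card * b ^ (T ∩ A).card *
          ((1 - b) ^ (A.card - (T ∩ A).card) * (1 - b) ^ (Aᶜ.card - (T \ A).card))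
        ≤ b ^ (T \ A).card * m ^ (T ∩ A).card *
          (m ^ (A.card - (T ∩ A).card) * (1 - b) ^ (Aᶜ.card - (T \ A).card)) := by
          gcongr
          · exact le_max_left _ _
          · exact le_max_right _ _
      _ = _ := by ring
  set G := Finset.univ.filter (fun T : Finset (Fin n) => ∀ x, x ∈ T ↔ f x ∈ T) with hG
  have hinj : Set.InjOn (fun T : Finset (Fin n) => T \ A) G := by
    intro T hT T' hT' h
    have hT : ∀ x, x ∈ T ↔ f x ∈ T := by simpa [hG] using hT
    have hT' : ∀ x, x ∈ T' ↔ f x ∈ T' := by simpa [hG] using hT'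
    ext x
    rw [hT, hT']
    have := Finset.ext_iff.1 h (f x)
    simpa [hfA x] using this
  calc ∑ T ∈ G, bern b T ≤ ∑ T ∈ G, m ^ A.card * w (T \ A) := Finset.sum_le_sum fun T _ => hle T
    _ = m ^ A.card * ∑ U ∈ G.image (fun T => T \ A), w U := by
        rw [← Finset.mul_sum, Finset.sum_image hinj]
    _ ≤ m ^ A.card * ∑ U ∈ Aᶜ.powerset, w U := by
        refine mul_le_mul_of_nonneg_left
          (Finset.sum_le_sum_of_subset_of_nonneg ?_ fun U _ _ => hw U) (pow_nonneg hm _)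
        intro U hU
        obtain ⟨T, _, rfl⟩ := Finset.mem_image.1 hU
        rw [Finset.mem_powerset]
        intro x hx
        simpa using (Finset.mem_sdiff.1 hx).2
    _ = m ^ A.card := by
        simp only [w]
        rw [Finset.sum_pow_mul_eq_add_pow]
        simp

/-- Either the structure collapses along few moved points, or an equivalent pair forces the set of
terminal states to be saturated for a relation moving more than `R` points. -/
theorem sum_bern_le {b : ℝ} (hb : 0 < b) (hb1 : b < 1) {n k : ℕ} (R : ℕ)
    (δ : Fin n → Fin k → Fin n) :
    (∑ T : Finset (Fin n),
      if (¬ ∃ i j : Fin n, IsMMotif δ i j) ∧ (∃ i j : Fin n, i ≠ j ∧ MNEquiv δ T i j)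
        then bern b T else 0) ≤
      (if ∃ f : Fin n → Fin n, (∀ x, f (f x) = f x) ∧ (moved f).Nonempty ∧ (moved f).card ≤ R ∧
          Collapses f δ then 1 else 0) + (n : ℝ) ^ 2 * max b (1 - b) ^ R := by
  have hm : 0 ≤ max b (1 - b) := hb.le.trans (le_max_left _ _)
  have hm1 : max b (1 - b) ≤ 1 := max_le hb1.le (by linarith)
  by_cases hM : ∃ i j : Fin n, IsMMotif δ i j
  · simp only [hM, not_true_eq_false, false_and, if_false, Finset.sum_const_zero]
    positivity
  by_cases hC : ∃ f : Fin n → Fin n, (∀ x, f (f x) = f x) ∧ (moved f).Nonempty ∧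
      (moved f).card ≤ R ∧ Collapses f δ
  · rw [if_pos hC]
    calc _ ≤ ∑ T : Finset (Fin n), bern b T := by
          refine Finset.sum_le_sum fun T _ => ?_
          split_ifs
          · exact le_rfl
          · exact bern_nonneg hb hb1 T
      _ = 1 := sum_bern b n
      _ ≤ _ := le_add_of_nonneg_right (by positivity)
  rw [if_neg hC, zero_add]
  choose f hid hij hc hsat using fun p : Fin n × Fin n => exists_representatives δ p.1 p.2
  have hbig : ∀ p : Fin n × Fin n, p.1 ≠ p.2 → R ≤ (moved (f p)).card := by
    intro p hp
    by_contra! h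
    refine hC ⟨f p, hid p, ?_, h.le, collapses_of_congruence (hid p) (hc p) hM⟩
    by_contra! h0
    have h1 : ∀ x, f p x = x := fun x => by
      have : x ∉ moved (f p) := by simp [h0]
      rwa [mem_moved, not_not] at this
    exact hp (by rw [← h1 p.1, ← h1 p.2, hij p])
  calc _ ≤ ∑ T : Finset (Fin n), ∑ p : Fin n × Fin n,
        if p.1 ≠ p.2 ∧ ∀ x, x ∈ T ↔ f p x ∈ T then bern b T else 0 := by
        refine Finset.sum_le_sum fun T _ => ?_
        have hnn : ∀ p ∈ (Finset.univ : Finset (Fin n × Fin n)),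
            0 ≤ if p.1 ≠ p.2 ∧ ∀ x, x ∈ T ↔ f p x ∈ T then bern b T else 0 := by
          intro p _
          split_ifs
          · exact bern_nonneg hb hb1 T
          · exact le_rfl
        split_ifs with h
        · obtain ⟨-, i, j, hne, hE⟩ := h
          refine le_trans (le_of_eq ?_) (Finset.single_le_sum hnn (Finset.mem_univ (i, j)))
          rw [if_pos ⟨hne, hsat (i, j) T hE⟩]
        · exact Finset.sum_nonneg hnn
    _ = ∑ p : Fin n × Fin n, ∑ T : Finset (Fin n),
        if p.1 ≠ p.2 ∧ ∀ x, x ∈ T ↔ f p x ∈ T then bern b T else 0 := Finset.sum_comm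
    _ ≤ ∑ p : Fin n × Fin n, max b (1 - b) ^ R := by
        refine Finset.sum_le_sum fun p _ => ?_
        by_cases hp : p.1 = p.2
        · simp only [hp, ne_eq, not_true_eq_false, false_and, if_false, Finset.sum_const_zero]
          positivity
        · simp only [ne_eq, hp, not_false_eq_true, true_and]
          rw [← Finset.sum_filter]
          exact (sum_bern_saturated_le hb hb1 (hid p)).trans
            (pow_le_pow_of_le_one hm hm1 (hbig p hp))
    _ = _ := by simp [sq]

theorem prob_le {b : ℝ} (hb : 0 < b) (hb1 : b < 1) {n k : ℕ} (hk : 1 ≤ k) (hn : 0 < n) (R : ℕ) :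
    (∑ δ : Fin n → Fin k → Fin n, ∑ T : Finset (Fin n),
      if (¬ ∃ i j : Fin n, IsMMotif δ i j) ∧ (∃ i j : Fin n, i ≠ j ∧ MNEquiv δ T i j)
        then bern b T else 0) / (n : ℝ) ^ (k * n) ≤
      2 * k * (R + 1) ^ (k + 4) / n ^ (k - 1) + (n : ℝ) ^ 2 * max b (1 - b) ^ R := by
  have hn' : (0 : ℝ) < n := by exact_mod_cast hn
  rw [div_le_iff₀ (by positivity)]
  refine (Finset.sum_le_sum fun δ _ => sum_bern_le hb hb1 R δ).trans ?_
  rw [Finset.sum_add_distrib, Finset.sum_boole, add_mul]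
  refine add_le_add ?_ (le_of_eq ?_)
  · rw [mul_comm]
    exact card_small_collapse_le hk hn R
  · simp [pow_mul]
    ring

theorem tendsto_log_pow_div_sqrt (K : ℕ) :
    Filter.Tendsto (fun n : ℕ => ((Nat.log 2 n + 1 : ℕ) : ℝ) ^ K / (n : ℝ) ^ ((1 : ℝ) / 2))
      Filter.atTop (nhds 0) := by
  have hlog : Filter.Tendsto (fun n => Nat.log 2 n + 1) Filter.atTop Filter.atTop := by
    refine Filter.tendsto_atTop_atTop.2 fun m => ⟨2 ^ m, fun n hn => ?_⟩
    exact (Nat.le_log_of_pow_le (by norm_num) hn).trans (Nat.le_succ _)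
  have hs : (1 : ℝ) < √2 := by rw [Real.lt_sqrt] <;> norm_num
  have h := ((tendsto_pow_const_div_const_pow_of_one_lt K hs).comp hlog).const_mul √2
  rw [mul_zero] at h
  refine squeeze_zero' (Filter.Eventually.of_forall fun n => by positivity) ?_ h
  filter_upwards [Filter.eventually_gt_atTop 0] with n hn
  have h2 : √2 ^ Nat.log 2 n ≤ (n : ℝ) ^ ((1 : ℝ) / 2) := by
    rw [← Real.sqrt_eq_rpow]
    apply Real.le_sqrt_of_sq_le
    rw [← pow_mul, mul_comm, pow_mul, Real.sq_sqrt (by norm_num)]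
    exact_mod_cast Nat.pow_log_le_self 2 hn.ne'
  simp only [Function.comp]
  rw [pow_succ √2, mul_div_assoc', mul_comm √2, mul_div_mul_right _ _ (by positivity)]
  gcongr

/-- For `k ≥ 2` and `0 < b < 1`, for a uniformly random `k`-map
`δ` on `n` states and an independent Bernoulli-`b` set `T` of terminal states,
the probability that `δ` contains no M-motif and yet two distinct
Myhill–Nerode-equivalent states exist is `o(n^{3/2-k})`. -/
theorem statement8 (k : ℕ) (hk : 2 ≤ k) (b : ℝ) (hb : 0 < b) (hb1 : b < 1) :
    Filter.Tendsto
      (fun n : ℕ =>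
        ((∑ δ : Fin n → Fin k → Fin n, ∑ T : Finset (Fin n),
            if (¬ ∃ i j : Fin n, IsMMotif δ i j) ∧
                (∃ i j : Fin n, i ≠ j ∧ MNEquiv δ T i j) then bern b T else 0) /
          ((n : ℝ) ^ (k * n))) / (n : ℝ) ^ ((3 : ℝ) / 2 - (k : ℝ)))
      Filter.atTop (nhds 0) := by
  have hm1 : max b (1 - b) < 1 := max_lt hb1 (by linarith)
  have hm : 0 < max b (1 - b) := lt_max_of_lt_left hb
  obtain ⟨D, hD⟩ := exists_pow_lt_of_lt_one (show (0 : ℝ) < (1 / 2) ^ (k + 1) by positivity) hm1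
  have hlim := (tendsto_log_pow_div_sqrt (k + 4)).const_mul
    (2 * k * ((D : ℝ) + 1) ^ (k + 4) + 1)
  rw [mul_zero] at hlim
  refine squeeze_zero' (Filter.Eventually.of_forall fun n => ?_) ?_ hlim
  · refine div_nonneg (div_nonneg (Finset.sum_nonneg fun δ _ => Finset.sum_nonneg fun T _ => ?_)
      (by positivity)) (by positivity)
    split_ifs
    · exact bern_nonneg hb hb1 T
    · exact le_rfl
  filter_upwards [Filter.eventually_gt_atTop 0] with n hn
  have hn' : (0 : ℝ) < n := by exact_mod_cast hn
  set s : ℕ := Nat.log 2 n + 1 with hs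
  have hs1 : (1 : ℝ) ≤ s := by rw [hs]; push_cast; linarith [(Nat.log 2 n).cast_nonneg (α := ℝ)]
  have hsat : (n : ℝ) ^ 2 * max b (1 - b) ^ (D * s) ≤ 1 / (n : ℝ) ^ (k - 1) := by
    have h2 : (n : ℝ) ≤ 2 ^ s := by exact_mod_cast (Nat.lt_pow_succ_log_self (by norm_num) n).le
    have h3 : max b (1 - b) ^ (D * s) ≤ 1 / (n : ℝ) ^ (k + 1) := by
      calc max b (1 - b) ^ (D * s) ≤ ((1 / 2) ^ (k + 1)) ^ s := by rw [pow_mul]; gcongr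
        _ = 1 / (2 ^ s) ^ (k + 1) := by
          rw [← pow_mul, ← pow_mul, mul_comm, one_div_pow]
        _ ≤ _ := by gcongr
    calc (n : ℝ) ^ 2 * max b (1 - b) ^ (D * s) ≤ (n : ℝ) ^ 2 * (1 / (n : ℝ) ^ (k + 1)) := by gcongr
      _ = _ := by
        rw [show k + 1 = 2 + (k - 1) by omega, pow_add]
        field_simp
  have hmain : 2 * k * (((D * s : ℕ) : ℝ) + 1) ^ (k + 4) ≤
      2 * k * ((D : ℝ) + 1) ^ (k + 4) * (s : ℝ) ^ (k + 4) := by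
    rw [mul_assoc _ (((D : ℝ) + 1) ^ (k + 4)), ← mul_pow]
    gcongr
    push_cast
    linarith
  have hone : (1 : ℝ) ≤ (s : ℝ) ^ (k + 4) := one_le_pow₀ hs1
  have hexp : (n : ℝ) ^ (k - 1) * (n : ℝ) ^ ((3 : ℝ) / 2 - k) = (n : ℝ) ^ ((1 : ℝ) / 2) := by
    rw [← Real.rpow_natCast, ← Real.rpow_add hn', Nat.cast_sub (by omega)]
    congr 1
    push_cast
    ring
  calc _ ≤ (2 * k * (((D * s : ℕ) : ℝ) + 1) ^ (k + 4) / n ^ (k - 1) +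
        (n : ℝ) ^ 2 * max b (1 - b) ^ (D * s)) / (n : ℝ) ^ ((3 : ℝ) / 2 - (k : ℝ)) := by
        gcongr
        exact prob_le hb hb1 (by omega) hn (D * s)
    _ ≤ (2 * k * ((D : ℝ) + 1) ^ (k + 4) * (s : ℝ) ^ (k + 4) / n ^ (k - 1) +
        (s : ℝ) ^ (k + 4) / (n : ℝ) ^ (k - 1)) / (n : ℝ) ^ ((3 : ℝ) / 2 - (k : ℝ)) := by
        gcongr
        exact hsat.trans (by gcongr)
    _ = _ := by
        rw [← hexp, ← add_div, div_div]
        ring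

end ArxivAutomata
end

section
/- Fix a real κ > 1 and let ω be the unique solution in (0,1) of -κω = ln(1-ω). Let M, M' : ℕ → ℕ be sequences such that |M(n) - κn| and |M'(n) - κn| are bounded. Then the ratio S(M(n), n) / ( S(M'(n), n) · (n/ω)^{M(n)-M'(n)} ) tends to 1 as n → ∞, where S(·,·) denotes the Stirling number of the second kind. -/
open scoped Classical BigOperators

namespace ArxivAutomata

/-- The Stirling number of the second kind `S(M, n)`: the number of partitions
of an `M`-element set into `n` nonempty blocks, i.e. the number of surjections
from `Fin M` onto `Fin n` divided by `n!`. -/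
noncomputable def stirling2 (M n : ℕ) : ℕ :=
  (Finset.univ.filter fun f : Fin M → Fin n => Function.Surjective f).card / n.factorial

lemma sum_descFactorial_mul_stirlingSecond (M n : ℕ) :
    ∑ k ∈ Finset.range (n + 1), n.descFactorial k * Nat.stirlingSecond M k = n ^ M := by
  induction M with
  | zero =>
    rw [Finset.sum_eq_single 0]
    · simp
    · intro k _ hk
      obtain ⟨k, rfl⟩ := Nat.exists_eq_succ_of_ne_zero hk
      simp
    · simp
  | succ M ih =>
    have h2 : ∑ k ∈ Finset.range (n + 1), n.descFactorial k * Nat.stirlingSecond (M + 1) k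
        = ∑ k ∈ Finset.range n, n.descFactorial (k + 1) * Nat.stirlingSecond M k
          + ∑ k ∈ Finset.range (n + 1), k * (n.descFactorial k * Nat.stirlingSecond M k) := by
      rw [Finset.sum_range_succ', Finset.sum_range_succ' _ n]
      simp only [Nat.stirlingSecond_succ_succ, Nat.stirlingSecond_succ_zero, mul_zero, zero_mul,
        add_zero, ← Finset.sum_add_distrib]
      exact Finset.sum_congr rfl fun k _ => by ring
    have h3 : ∑ k ∈ Finset.range n, n.descFactorial (k + 1) * Nat.stirlingSecond M k
        = ∑ k ∈ Finset.range (n + 1), n.descFactorial (k + 1) * Nat.stirlingSecond M k := by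
      rw [Finset.sum_range_succ]; simp
    rw [h2, h3, ← Finset.sum_add_distrib, pow_succ, ← ih, Finset.sum_mul]
    refine Finset.sum_congr rfl fun k hk => ?_
    have hk' : k ≤ n := Nat.lt_succ_iff.mp (Finset.mem_range.mp hk)
    rw [Nat.descFactorial_succ]
    obtain ⟨d, rfl⟩ := Nat.exists_eq_add_of_le hk'
    rw [Nat.add_sub_cancel_left]
    ring

lemma sum_choose_mul_factorial_mul_stirlingSecond (M n : ℕ) :
    ∑ k ∈ Finset.range (n + 1), n.choose k * (k.factorial * Nat.stirlingSecond M k) = n ^ M := by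
  rw [← sum_descFactorial_mul_stirlingSecond M n]
  refine Finset.sum_congr rfl fun k _ => ?_
  rw [Nat.descFactorial_eq_factorial_mul_choose]; ring

/-- The functions with a given image are the surjections onto that image. -/
lemma card_filter_image_eq (M : ℕ) {n : ℕ} (s : Finset (Fin n)) :
    (Finset.univ.filter fun f : Fin M → Fin n => Finset.univ.image f = s).card
      = (Finset.univ.filter fun f : Fin M → Fin s.card => Function.Surjective f).card := by
  let e := s.equivFin
  symm
  refine Finset.card_bij (fun f _ i => (e.symm (f i) : Fin n)) ?_ ?_ ?_
  · intro f hf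
    have hf' : Function.Surjective f := by simpa using hf
    simp only [Finset.mem_filter, Finset.mem_univ, true_and]
    ext x
    simp only [Finset.mem_image, Finset.mem_univ, true_and]
    constructor
    · rintro ⟨i, rfl⟩; exact (e.symm (f i)).2
    · intro hx
      obtain ⟨i, hi⟩ := hf' (e ⟨x, hx⟩)
      exact ⟨i, by simp [hi]⟩
  · intro f _ g _ h
    funext i
    exact e.symm.injective (Subtype.ext (congrFun h i))
  · intro g hg
    have hg' : Finset.univ.image g = s := by simpa using hg
    have hmem : ∀ i, g i ∈ s := fun i => by
      rw [← hg']; exact Finset.mem_image_of_mem g (Finset.mem_univ i)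
    refine ⟨fun i => e ⟨g i, hmem i⟩, ?_, ?_⟩
    · simp only [Finset.mem_filter, Finset.mem_univ, true_and]
      intro b
      have hb : (e.symm b : Fin n) ∈ Finset.univ.image g := by rw [hg']; exact (e.symm b).2
      obtain ⟨i, _, hi⟩ := Finset.mem_image.mp hb
      exact ⟨i, by simp [hi]⟩
    · funext i; simp

lemma sum_choose_mul_card_surjective (M n : ℕ) :
    ∑ k ∈ Finset.range (n + 1),
      n.choose k * (Finset.univ.filter fun f : Fin M → Fin k => Function.Surjective f).card
      = n ^ M := by
  have h := Finset.card_eq_sum_card_fiberwise (s := (Finset.univ : Finset (Fin M → Fin n)))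
    (t := (Finset.univ : Finset (Fin n)).powerset) (f := fun f => Finset.univ.image f)
    (by intro f _; simp)
  simp only [card_filter_image_eq] at h
  rw [Finset.sum_powerset_apply_card
    (fun k => (Finset.univ.filter fun f : Fin M → Fin k => Function.Surjective f).card)] at h
  simpa using h.symm

lemma card_surjective (M n : ℕ) :
    (Finset.univ.filter fun f : Fin M → Fin n => Function.Surjective f).card
      = n.factorial * Nat.stirlingSecond M n := by
  induction n using Nat.strong_induction_on with
  | _ n ih =>
    have h := (sum_choose_mul_card_surjective M n).trans
      (sum_choose_mul_factorial_mul_stirlingSecond M n).symm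
    rw [Finset.sum_range_succ, Finset.sum_range_succ,
      Finset.sum_congr rfl fun k hk => by rw [ih k (Finset.mem_range.mp hk)]] at h
    simpa using h

lemma stirling2_eq_stirlingSecond (M n : ℕ) : stirling2 M n = Nat.stirlingSecond M n := by
  rw [stirling2, card_surjective, Nat.mul_div_cancel_left _ n.factorial_pos]

lemma stirlingSecond_pos {m n : ℕ} (hn : 0 < n) (h : n ≤ m) : 0 < Nat.stirlingSecond m n := by
  induction m generalizing n with
  | zero => omega
  | succ m ih =>
    obtain ⟨k, rfl⟩ := Nat.exists_eq_succ_of_ne_zero hn.ne'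
    rw [Nat.stirlingSecond_succ_succ]
    rcases h.eq_or_lt with h' | h'
    · have : m = k := by omega
      subst this
      simp [Nat.stirlingSecond_self]
    · have := ih (Nat.succ_pos k) (by omega)
      positivity

/-- Log-concavity of Stirling numbers in the first argument. -/
lemma stirlingSecond_mul_le_sq (m n : ℕ) :
    Nat.stirlingSecond m n * Nat.stirlingSecond (m + 2) n ≤ Nat.stirlingSecond (m + 1) n ^ 2 := by
  induction n generalizing m with
  | zero => simp
  | succ k ih =>
    have cross : ∀ m, Nat.stirlingSecond m (k + 1) * Nat.stirlingSecond (m + 1) k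
        ≤ Nat.stirlingSecond (m + 1) (k + 1) * Nat.stirlingSecond m k := by
      intro m
      induction m with
      | zero => simp
      | succ m ihm =>
        have key : Nat.stirlingSecond m (k + 1) * Nat.stirlingSecond (m + 2) k
            ≤ Nat.stirlingSecond (m + 1) (k + 1) * Nat.stirlingSecond (m + 1) k := by
          rcases Nat.eq_zero_or_pos (Nat.stirlingSecond (m + 1) k) with h0 | hpos
          · rcases Nat.eq_zero_or_pos k with rfl | hk
            · simp
            · have : m + 1 < k := by
                by_contra hcon
                have := stirlingSecond_pos hk (not_lt.mp hcon)
                omega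
              simp [Nat.stirlingSecond_eq_zero_of_lt (show m < k + 1 by omega)]
          · refine Nat.le_of_mul_le_mul_right ?_ hpos
            calc _ = (Nat.stirlingSecond m (k + 1) * Nat.stirlingSecond (m + 1) k)
                  * Nat.stirlingSecond (m + 2) k := by ring
              _ ≤ (Nat.stirlingSecond (m + 1) (k + 1) * Nat.stirlingSecond m k)
                  * Nat.stirlingSecond (m + 2) k := Nat.mul_le_mul_right _ ihm
              _ = Nat.stirlingSecond (m + 1) (k + 1)
                  * (Nat.stirlingSecond m k * Nat.stirlingSecond (m + 2) k) := by ring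
              _ ≤ Nat.stirlingSecond (m + 1) (k + 1) * Nat.stirlingSecond (m + 1) k ^ 2 :=
                Nat.mul_le_mul_left _ (ih m)
              _ = _ := by ring
        have e1 := Nat.stirlingSecond_succ_succ m k
        have e2 := Nat.stirlingSecond_succ_succ (m + 1) k
        have := ih m
        calc _ = (k + 1) * (Nat.stirlingSecond m (k + 1) * Nat.stirlingSecond (m + 2) k)
              + Nat.stirlingSecond m k * Nat.stirlingSecond (m + 2) k := by rw [e1]; ring
          _ ≤ (k + 1) * (Nat.stirlingSecond (m + 1) (k + 1) * Nat.stirlingSecond (m + 1) k)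
              + Nat.stirlingSecond (m + 1) k ^ 2 := by gcongr
          _ = _ := by rw [e2]; ring
    have e1 := Nat.stirlingSecond_succ_succ (m + 1) k
    have e2 := Nat.stirlingSecond_succ_succ m k
    calc _ = (k + 1) * (Nat.stirlingSecond m (k + 1) * Nat.stirlingSecond (m + 1) (k + 1))
          + Nat.stirlingSecond m (k + 1) * Nat.stirlingSecond (m + 1) k := by rw [e1]; ring
      _ ≤ (k + 1) * (Nat.stirlingSecond m (k + 1) * Nat.stirlingSecond (m + 1) (k + 1))
          + Nat.stirlingSecond (m + 1) (k + 1) * Nat.stirlingSecond m k := 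
        Nat.add_le_add_left (cross m) _
      _ = Nat.stirlingSecond (m + 1) (k + 1)
          * ((k + 1) * Nat.stirlingSecond m (k + 1) + Nat.stirlingSecond m k) := by ring
      _ = _ := by rw [← e2]; ring

/-- The coefficient of `x ^ k` in `(exp x - 1) ^ n`. -/
noncomputable def expSubOnePowCoeff (n k : ℕ) : ℝ :=
  (n.factorial * Nat.stirlingSecond k n : ℝ) / k.factorial

lemma hasSum_expSubOnePowCoeff (n : ℕ) (x : ℝ) :
    HasSum (fun k => expSubOnePowCoeff n k * x ^ k) ((Real.exp x - 1) ^ n) := by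
  induction n using Nat.strong_induction_on with
  | _ n ih =>
    have hexp : HasSum (fun k : ℕ => (n * x) ^ k / (k.factorial : ℝ)) (Real.exp (n * x)) := by
      rw [Real.exp_eq_exp_ℝ]
      exact NormedSpace.expSeries_div_hasSum_exp (n * x)
    have h := hexp.sub (hasSum_sum (s := Finset.range n) fun k hk =>
      (ih k (Finset.mem_range.mp hk)).mul_left (n.choose k : ℝ))
    convert h using 1
    · rfl
    · funext k
      have e : (n : ℝ) ^ k = ∑ j ∈ Finset.range (n + 1),
          (n.choose j : ℝ) * (j.factorial * Nat.stirlingSecond k j) := by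
        exact_mod_cast (sum_choose_mul_factorial_mul_stirlingSecond k n).symm
      rw [mul_pow, e, Finset.sum_range_succ, add_mul, add_div, Finset.sum_mul, Finset.sum_div,
        add_sub_right_comm, ← Finset.sum_sub_distrib, Finset.sum_eq_zero, zero_add]
      · simp [expSubOnePowCoeff]; ring
      · intro j _
        simp only [expSubOnePowCoeff]; ring
    · have e : Real.exp (n * x) = ((Real.exp x - 1) + 1) ^ n := by
        rw [sub_add_cancel, ← Real.exp_nat_mul]
      rw [e, add_pow, Finset.sum_range_succ]
      simp [mul_comm]

lemma expSubOnePowCoeff_nonneg (n k : ℕ) : 0 ≤ expSubOnePowCoeff n k := by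
  unfold expSubOnePowCoeff; positivity

lemma expSubOnePowCoeff_pos {n k : ℕ} (hn : 0 < n) (h : n ≤ k) : 0 < expSubOnePowCoeff n k := by
  have := stirlingSecond_pos hn h
  unfold expSubOnePowCoeff; positivity

lemma expSubOnePowCoeff_eq_zero {n k : ℕ} (h : k < n) : expSubOnePowCoeff n k = 0 := by
  simp [expSubOnePowCoeff, Nat.stirlingSecond_eq_zero_of_lt h]

lemma expSubOnePowCoeff_mul_le_sq (n k : ℕ) :
    expSubOnePowCoeff n k * expSubOnePowCoeff n (k + 2) ≤ expSubOnePowCoeff n (k + 1) ^ 2 := by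
  have h : (Nat.stirlingSecond k n : ℝ) * Nat.stirlingSecond (k + 2) n
      ≤ (Nat.stirlingSecond (k + 1) n : ℝ) ^ 2 := by exact_mod_cast stirlingSecond_mul_le_sq k n
  have hf : ((k + 1).factorial : ℝ) ^ 2 ≤ k.factorial * (k + 2).factorial := by
    rw [Nat.factorial_succ (k + 1), Nat.factorial_succ k]
    push_cast
    have : (0 : ℝ) < k.factorial := by positivity
    nlinarith [mul_pos this this, mul_pos (mul_pos this this) (by positivity : (0 : ℝ) < k + 1)]
  unfold expSubOnePowCoeff
  rw [div_mul_div_comm, div_pow]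
  refine div_le_div₀ (by positivity) ?_ (by positivity) hf
  calc _ = (n.factorial : ℝ) ^ 2 * (Nat.stirlingSecond k n * Nat.stirlingSecond (k + 2) n) := by
        ring
    _ ≤ (n.factorial : ℝ) ^ 2 * (Nat.stirlingSecond (k + 1) n : ℝ) ^ 2 := by gcongr
    _ = _ := by ring

/-- A power series whose coefficients decay geometrically from index `M` on cannot grow faster
than `y ^ M`. -/
lemma hasSum_le_of_ratio_le {a : ℕ → ℝ} (ha : ∀ k, 0 ≤ a k) {x y z Fy Fz : ℝ} {M : ℕ}
    (hz : 0 < z) (hzy : z < y) (hyx : y < x) (hr : ∀ k, M ≤ k → a (k + 1) * x ≤ a k)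
    (hFy : HasSum (fun k => a k * y ^ k) Fy) (hFz : HasSum (fun k => a k * z ^ k) Fz) :
    Fy ≤ (1 + (1 - y / x)⁻¹) * (y / z) ^ M * Fz := by
  have hy : 0 < y := hz.trans hzy
  have hx : 0 < x := hy.trans hyx
  have hyz : 1 ≤ y / z := (one_le_div hz).mpr hzy.le
  have hpow : ∀ k, y ^ k = (y / z) ^ k * z ^ k := fun k => by
    rw [← mul_pow, div_mul_cancel₀ _ hz.ne']
  have hterm : ∀ k, 0 ≤ a k * z ^ k := fun k => mul_nonneg (ha k) (by positivity)
  have hM : a M * y ^ M ≤ (y / z) ^ M * Fz := by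
    have := le_hasSum hFz M fun k _ => hterm k
    calc a M * y ^ M = (y / z) ^ M * (a M * z ^ M) := by rw [hpow M]; ring
      _ ≤ _ := by gcongr
  have htail : ∀ j, a (j + M) * y ^ (j + M) ≤ (y / z) ^ M * Fz * (y / x) ^ j := by
    intro j
    induction j with
    | zero => simpa using hM
    | succ j ih =>
      have h1 := hr (j + M) (Nat.le_add_left _ _)
      calc a (j + 1 + M) * y ^ (j + 1 + M)
          = (a (j + M + 1) * x) * y ^ (j + M) * (y / x) := by
            rw [show j + 1 + M = j + M + 1 by ring, pow_succ]; field_simp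
        _ ≤ a (j + M) * y ^ (j + M) * (y / x) := by gcongr
        _ ≤ ((y / z) ^ M * Fz * (y / x) ^ j) * (y / x) := by gcongr
        _ = _ := by ring
  have hgeo : HasSum (fun j => (y / z) ^ M * Fz * (y / x) ^ j)
      ((y / z) ^ M * Fz * (1 - y / x)⁻¹) :=
    (hasSum_geometric_of_lt_one (by positivity) ((div_lt_one hx).mpr hyx)).mul_left _
  have hhead : ∑ k ∈ Finset.range M, a k * y ^ k ≤ (y / z) ^ M * Fz := by
    calc ∑ k ∈ Finset.range M, a k * y ^ k
        ≤ ∑ k ∈ Finset.range M, (y / z) ^ M * (a k * z ^ k) := by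
          refine Finset.sum_le_sum fun k hk => ?_
          rw [hpow k, mul_left_comm]
          exact mul_le_mul_of_nonneg_right
            (pow_le_pow_right₀ hyz (Finset.mem_range.mp hk).le) (hterm k)
      _ = (y / z) ^ M * ∑ k ∈ Finset.range M, a k * z ^ k := by rw [Finset.mul_sum]
      _ ≤ _ := by
          have := sum_le_hasSum (Finset.range M) (fun k _ => hterm k) hFz
          gcongr
  rw [← hFy.tsum_eq, ← hFy.summable.sum_add_tsum_nat_add M]
  have := ((summable_nat_add_iff M).mpr hFy.summable).tsum_le_tsum htail hgeo.summable
  rw [hgeo.tsum_eq] at this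
  linarith

/-- A power series whose coefficients grow geometrically up to index `N` cannot decay more slowly
than `y ^ N`. -/
lemma hasSum_le_of_le_ratio {a : ℕ → ℝ} (ha : ∀ k, 0 ≤ a k) {x y z Fy Fz : ℝ} {N : ℕ}
    (hx : 0 < x) (hxy : x < y) (hyz : y < z) (hr : ∀ k, k < N → a k ≤ a (k + 1) * x)
    (hFy : HasSum (fun k => a k * y ^ k) Fy) (hFz : HasSum (fun k => a k * z ^ k) Fz) :
    Fy ≤ (1 + (1 - x / y)⁻¹) * (y / z) ^ N * Fz := by
  have hy : 0 < y := hx.trans hxy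
  have hz : 0 < z := hy.trans hyz
  have hyz' : y / z ≤ 1 := (div_le_one hz).mpr hyz.le
  have hpow : ∀ k, y ^ k = (y / z) ^ k * z ^ k := fun k => by
    rw [← mul_pow, div_mul_cancel₀ _ hz.ne']
  have hterm : ∀ k, 0 ≤ a k * z ^ k := fun k => mul_nonneg (ha k) (by positivity)
  have hN : a N * y ^ N ≤ (y / z) ^ N * Fz := by
    have := le_hasSum hFz N fun k _ => hterm k
    calc a N * y ^ N = (y / z) ^ N * (a N * z ^ N) := by rw [hpow N]; ring
      _ ≤ _ := by gcongr
  have hFz0 : 0 ≤ Fz := hFz.nonneg hterm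
  have hhead : ∀ j, j ≤ N → a (N - j) * y ^ (N - j) ≤ (y / z) ^ N * Fz * (x / y) ^ j := by
    intro j
    induction j with
    | zero => intro _; simpa using hN
    | succ j ih =>
      intro hj
      have h1 := hr (N - (j + 1)) (by omega)
      have e : N - (j + 1) + 1 = N - j := by omega
      have ih' := ih (by omega)
      rw [← e] at ih'
      calc a (N - (j + 1)) * y ^ (N - (j + 1))
          ≤ (a (N - (j + 1) + 1) * x) * y ^ (N - (j + 1)) := by gcongr
        _ = a (N - (j + 1) + 1) * y ^ (N - (j + 1) + 1) * (x / y) := by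
            rw [pow_succ]; field_simp
        _ ≤ ((y / z) ^ N * Fz * (x / y) ^ j) * (x / y) := by gcongr
        _ = _ := by ring
  have hgeo : HasSum (fun j => (y / z) ^ N * Fz * (x / y) ^ j)
      ((y / z) ^ N * Fz * (1 - x / y)⁻¹) :=
    (hasSum_geometric_of_lt_one (by positivity) ((div_lt_one hy).mpr hxy)).mul_left _
  have hheadsum : ∑ k ∈ Finset.range N, a k * y ^ k ≤ (y / z) ^ N * Fz * (1 - x / y)⁻¹ := by
    rw [← Finset.sum_range_reflect]
    calc ∑ j ∈ Finset.range N, a (N - 1 - j) * y ^ (N - 1 - j)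
        ≤ ∑ j ∈ Finset.range N, (y / z) ^ N * Fz * (x / y) ^ j := by
          refine Finset.sum_le_sum fun j hj => ?_
          have hj' := Finset.mem_range.mp hj
          have h1 := hhead (j + 1) hj'
          rw [show N - (j + 1) = N - 1 - j by omega] at h1
          refine h1.trans ?_
          have hxy1 : x / y ≤ 1 := (div_le_one hy).mpr hxy.le
          exact mul_le_mul_of_nonneg_left
            (pow_le_pow_of_le_one (by positivity) hxy1 (Nat.le_succ j)) (by positivity)
      _ ≤ _ := sum_le_hasSum _ (fun j _ => by positivity) hgeo
  have htail : ∀ j, a (j + N) * y ^ (j + N) ≤ (y / z) ^ N * (a (j + N) * z ^ (j + N)) := by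
    intro j
    rw [hpow (j + N), mul_left_comm]
    exact mul_le_mul_of_nonneg_right
      (pow_le_pow_of_le_one (by positivity) hyz' (Nat.le_add_left _ _)) (hterm _)
  have hz' := (summable_nat_add_iff N).mpr hFz.summable
  have h2 := ((summable_nat_add_iff N).mpr hFy.summable).tsum_le_tsum htail (hz'.mul_left _)
  rw [tsum_mul_left] at h2
  have h3 : ∑' j, a (j + N) * z ^ (j + N) ≤ Fz := by
    rw [← hFz.tsum_eq, ← hFz.summable.sum_add_tsum_nat_add N]
    exact le_add_of_nonneg_left (Finset.sum_nonneg fun k _ => hterm k)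
  have h4 : (y / z) ^ N * ∑' j, a (j + N) * z ^ (j + N) ≤ (y / z) ^ N * Fz := by gcongr
  rw [← hFy.tsum_eq, ← hFy.summable.sum_add_tsum_nat_add N]
  linarith

lemma expSubOnePowCoeff_ratio_le {n m : ℕ} (hn : 0 < n) (hm : n ≤ m) {x : ℝ} (hx : 0 < x)
    (h : expSubOnePowCoeff n (m + 1) * x ≤ expSubOnePowCoeff n m) (k : ℕ) (hk : m ≤ k) :
    expSubOnePowCoeff n (k + 1) * x ≤ expSubOnePowCoeff n k := by
  induction k, hk using Nat.le_induction with
  | base => exact h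
  | succ k hk ih =>
    have hpos := expSubOnePowCoeff_pos hn (hm.trans hk)
    have hlc := expSubOnePowCoeff_mul_le_sq n k
    have h0 := expSubOnePowCoeff_nonneg n (k + 1)
    refine le_of_mul_le_mul_left ?_ hpos
    nlinarith [mul_le_mul_of_nonneg_right hlc hx.le, mul_le_mul_of_nonneg_left ih h0]

lemma expSubOnePowCoeff_le_ratio {n m : ℕ} (hn : 0 < n) {x : ℝ} (hx : 0 < x)
    (h : expSubOnePowCoeff n m ≤ expSubOnePowCoeff n (m + 1) * x) (k : ℕ) (hk : k < m + 1) :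
    expSubOnePowCoeff n k ≤ expSubOnePowCoeff n (k + 1) * x := by
  induction m with
  | zero =>
    obtain rfl : k = 0 := by omega
    exact h
  | succ m ih =>
    rcases Nat.lt_succ_iff_lt_or_eq.mp hk with hk' | rfl
    · refine ih ?_ hk'
      rcases lt_or_ge (m + 1) n with hlt | hge
      · rw [expSubOnePowCoeff_eq_zero (show m < n by omega), expSubOnePowCoeff_eq_zero hlt,
          zero_mul]
      · have hpos := expSubOnePowCoeff_pos hn hge
        have hlc := expSubOnePowCoeff_mul_le_sq n m
        have h0 := expSubOnePowCoeff_nonneg n m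
        refine le_of_mul_le_mul_left ?_ hpos
        nlinarith [mul_le_mul_of_nonneg_right hlc hx.le, mul_le_mul_of_nonneg_left h h0]
    · exact h

/-- The logarithm of `(exp s - 1) / s ^ κ`. -/
noncomputable def logGrowth (κ s : ℝ) : ℝ := Real.log (Real.exp s - 1) - κ * Real.log s

lemma eventually_mul_pow_lt {κ C K y z : ℝ} (hy : 0 < y) (hz : 0 < z) (hK : 0 < K)
    (h : logGrowth κ z < logGrowth κ y) :
    ∀ᶠ n : ℕ in Filter.atTop, ∀ N : ℕ, |(N : ℝ) - κ * n| ≤ C →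
      K * (y / z) ^ N * (Real.exp z - 1) ^ n < (Real.exp y - 1) ^ n := by
  have hyp : 0 < Real.exp y - 1 := sub_pos.mpr (Real.one_lt_exp_iff.mpr hy)
  have hzp : 0 < Real.exp z - 1 := sub_pos.mpr (Real.one_lt_exp_iff.mpr hz)
  have ht := (tendsto_natCast_atTop_atTop (R := ℝ)).atTop_mul_const (sub_pos.mpr h)
  filter_upwards [ht.eventually_gt_atTop (Real.log K + C * |Real.log y - Real.log z|)]
    with n hn N hN
  rw [← Real.log_lt_log_iff (by positivity) (by positivity),
    Real.log_mul (by positivity) (by positivity), Real.log_mul (by positivity) (by positivity),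
    Real.log_pow, Real.log_pow, Real.log_pow, Real.log_div hy.ne' hz.ne']
  have h1 : ((N : ℝ) - κ * n) * (Real.log y - Real.log z) ≤ C * |Real.log y - Real.log z| :=
    (le_abs_self _).trans (by rw [abs_mul]; gcongr)
  simp only [logGrowth] at hn
  linarith

lemma hasDerivAt_logGrowth (κ : ℝ) {s : ℝ} (hs : 0 < s) :
    HasDerivAt (logGrowth κ) (Real.exp s / (Real.exp s - 1) - κ * s⁻¹) s := by
  have hp : 0 < Real.exp s - 1 := sub_pos.mpr (Real.one_lt_exp_iff.mpr hs)
  exact (((Real.hasDerivAt_exp s).sub_const 1).log hp.ne').sub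
    ((Real.hasDerivAt_log hs.ne').const_mul κ)

lemma deriv_logGrowth_eq (κ : ℝ) {s : ℝ} (hs : 0 < s) :
    Real.exp s / (Real.exp s - 1) - κ * s⁻¹
      = (s - κ * (1 - Real.exp (-s))) / (s * (1 - Real.exp (-s))) := by
  have hp : 0 < Real.exp s - 1 := sub_pos.mpr (Real.one_lt_exp_iff.mpr hs)
  have hp' : 0 < 1 - Real.exp (-s) := sub_pos.mpr (Real.exp_lt_one_iff.mpr (by linarith))
  have e : Real.exp s / (Real.exp s - 1) = 1 / (1 - Real.exp (-s)) := by
    rw [div_eq_div_iff hp.ne' hp'.ne', mul_sub, ← Real.exp_add]; simp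
  rw [e]; field_simp

/-- Strict concavity of `s ↦ 1 - exp (-s)`, as monotonicity of its secant slopes from `0`. -/
lemma mul_one_sub_exp_neg_lt {s t : ℝ} (hs : 0 < s) (hst : s < t) :
    s * (1 - Real.exp (-t)) < t * (1 - Real.exp (-s)) := by
  have h := strictConvexOn_exp.secant_strict_mono (a := 0) (x := -t) (y := -s)
    (Set.mem_univ _) (Set.mem_univ _) (Set.mem_univ _) (by linarith) (by linarith) (by linarith)
  have ht : 0 < t := hs.trans hst
  rw [Real.exp_zero, sub_zero, sub_zero, div_neg, div_neg, neg_lt_neg_iff,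
    div_lt_div_iff₀ hs ht] at h
  linarith

lemma strictMonoOn_logGrowth {κ x₀ : ℝ} (h0 : 0 < x₀) (hx₀ : κ * (1 - Real.exp (-x₀)) = x₀) :
    StrictMonoOn (logGrowth κ) (Set.Ici x₀) := by
  refine strictMonoOn_of_deriv_pos (convex_Ici _) (fun s hs =>
    (hasDerivAt_logGrowth κ (h0.trans_le hs)).continuousAt.continuousWithinAt) fun s hs => ?_
  rw [interior_Ici, Set.mem_Ioi] at hs
  have hs0 := h0.trans hs
  rw [(hasDerivAt_logGrowth κ hs0).deriv, deriv_logGrowth_eq κ hs0]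
  have hp' : 0 < 1 - Real.exp (-s) := sub_pos.mpr (Real.exp_lt_one_iff.mpr (by linarith))
  have hq : 0 < 1 - Real.exp (-x₀) := sub_pos.mpr (Real.exp_lt_one_iff.mpr (by linarith))
  have h := mul_one_sub_exp_neg_lt h0 hs
  refine div_pos ?_ (by positivity)
  have : 0 < (1 - Real.exp (-x₀)) * (s - κ * (1 - Real.exp (-s))) := by
    nlinarith [congrArg (· * (1 - Real.exp (-s))) hx₀]
  exact pos_of_mul_pos_right this hq.le

lemma strictAntiOn_logGrowth {κ x₀ : ℝ} (hx₀ : κ * (1 - Real.exp (-x₀)) = x₀) :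
    StrictAntiOn (logGrowth κ) (Set.Ioc 0 x₀) := by
  refine strictAntiOn_of_deriv_neg (convex_Ioc _ _) (fun s hs =>
    (hasDerivAt_logGrowth κ hs.1).continuousAt.continuousWithinAt) fun s hs => ?_
  rw [interior_Ioc, Set.mem_Ioo] at hs
  have hs0 := hs.1
  rw [(hasDerivAt_logGrowth κ hs0).deriv, deriv_logGrowth_eq κ hs0]
  have hp' : 0 < 1 - Real.exp (-s) := sub_pos.mpr (Real.exp_lt_one_iff.mpr (by linarith))
  have hq : 0 < 1 - Real.exp (-x₀) :=
    sub_pos.mpr (Real.exp_lt_one_iff.mpr (by linarith [hs.1.trans hs.2]))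
  have h := mul_one_sub_exp_neg_lt hs0 hs.2
  refine div_neg_of_neg_of_pos ?_ (by positivity)
  have : 0 < (1 - Real.exp (-x₀)) * (κ * (1 - Real.exp (-s)) - s) := by
    nlinarith [congrArg (· * (1 - Real.exp (-s))) hx₀]
  linarith [pos_of_mul_pos_right this hq.le]

lemma eventually_le_natCast {κ C : ℝ} (hκ : 1 < κ) :
    ∀ᶠ n : ℕ in Filter.atTop, ∀ m : ℕ, |(m : ℝ) - κ * n| ≤ C → n ≤ m := by
  have ht := (tendsto_natCast_atTop_atTop (R := ℝ)).atTop_mul_const (sub_pos.mpr hκ)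
  filter_upwards [ht.eventually_ge_atTop C] with n hn m hm
  have := (abs_le.mp hm).1
  exact_mod_cast (by linarith : (n : ℝ) ≤ m)

lemma eventually_coeff_lt {κ C x₀ x : ℝ} (hκ : 1 < κ) (h0 : 0 < x₀)
    (hx₀ : κ * (1 - Real.exp (-x₀)) = x₀) (hx : x₀ < x) :
    ∀ᶠ n : ℕ in Filter.atTop, ∀ m : ℕ, |(m : ℝ) - κ * n| ≤ C →
      expSubOnePowCoeff n m < expSubOnePowCoeff n (m + 1) * x := by
  obtain ⟨y, hy, hyx⟩ := exists_between hx
  have hy0 := h0.trans hy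
  have hK : 0 < 1 + (1 - y / x)⁻¹ := by
    have : 0 < 1 - y / x := sub_pos.mpr ((div_lt_one (hy0.trans hyx)).mpr hyx)
    positivity
  filter_upwards [eventually_le_natCast (C := C) hκ, Filter.eventually_gt_atTop 0,
    eventually_mul_pow_lt (C := C) hy0 h0 hK
      (strictMonoOn_logGrowth h0 hx₀ Set.self_mem_Ici hy.le hy)] with n h1 hn h2 m hm
  by_contra! hcon
  exact (h2 m hm).not_ge <| hasSum_le_of_ratio_le (expSubOnePowCoeff_nonneg n) h0 hy hyx
    (expSubOnePowCoeff_ratio_le hn (h1 m hm) (h0.trans hx) hcon)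
    (hasSum_expSubOnePowCoeff n y) (hasSum_expSubOnePowCoeff n x₀)

lemma eventually_lt_coeff {κ C x₀ x : ℝ} (hx0 : 0 < x)
    (hx₀ : κ * (1 - Real.exp (-x₀)) = x₀) (hx : x < x₀) :
    ∀ᶠ n : ℕ in Filter.atTop, ∀ m : ℕ, |(m : ℝ) - κ * n| ≤ C →
      expSubOnePowCoeff n (m + 1) * x < expSubOnePowCoeff n m := by
  obtain ⟨y, hxy, hy⟩ := exists_between hx
  have hy0 := hx0.trans hxy
  have h0 := hx0.trans hx
  have hK : 0 < 1 + (1 - x / y)⁻¹ := by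
    have : 0 < 1 - x / y := sub_pos.mpr ((div_lt_one hy0).mpr hxy)
    positivity
  filter_upwards [Filter.eventually_gt_atTop 0,
    eventually_mul_pow_lt (C := C + 1) hy0 h0 hK
      (strictAntiOn_logGrowth hx₀ ⟨hy0, hy.le⟩ ⟨h0, le_rfl⟩ hy)] with n hn h2 m hm
  by_contra! hcon
  refine (h2 (m + 1) ?_).not_ge <| hasSum_le_of_le_ratio (expSubOnePowCoeff_nonneg n) hx0 hxy hy
    (expSubOnePowCoeff_le_ratio hn hx0 hcon)
    (hasSum_expSubOnePowCoeff n y) (hasSum_expSubOnePowCoeff n x₀)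
  rw [abs_le] at hm ⊢
  push_cast
  constructor <;> linarith [hm.1, hm.2]

lemma tendsto_coeff_ratio {κ C x₀ : ℝ} (hκ : 1 < κ) (h0 : 0 < x₀)
    (hx₀ : κ * (1 - Real.exp (-x₀)) = x₀) {m : ℕ → ℕ} (hm : ∀ n : ℕ, |(m n : ℝ) - κ * n| ≤ C) :
    Filter.Tendsto (fun n => expSubOnePowCoeff n (m n) / expSubOnePowCoeff n (m n + 1))
      Filter.atTop (nhds x₀) := by
  have hpos : ∀ᶠ n : ℕ in Filter.atTop, 0 < expSubOnePowCoeff n (m n + 1) := by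
    filter_upwards [eventually_le_natCast (C := C) hκ, Filter.eventually_gt_atTop 0] with n h1 hn
    exact expSubOnePowCoeff_pos hn ((h1 _ (hm n)).trans (Nat.le_succ _))
  rw [tendsto_order]
  constructor
  · intro x hx
    have hx' : max x (x₀ / 2) < x₀ := max_lt hx (by linarith)
    filter_upwards [hpos, eventually_lt_coeff (C := C)
      (lt_max_of_lt_right (half_pos h0)) hx₀ hx'] with n hp h
    rw [lt_div_iff₀ hp]
    refine lt_of_le_of_lt ?_ (h _ (hm n))
    rw [mul_comm]
    gcongr
    exact le_max_left _ _
  · intro x hx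
    filter_upwards [hpos, eventually_coeff_lt (C := C) hκ h0 hx₀ hx] with n hp h
    rw [div_lt_iff₀ hp, mul_comm]
    exact h _ (hm n)

/-- The Stirling number normalised by its asymptotic growth in the first argument. -/
noncomputable def scaledStirling (ω : ℝ) (n m : ℕ) : ℝ := stirling2 m n * (ω / n) ^ m

lemma tendsto_scaledStirling_succ {κ C ω : ℝ} (hκ : 1 < κ) (hω : 0 < ω)
    (hωeq : 1 - Real.exp (-(κ * ω)) = ω) {m : ℕ → ℕ} (hm : ∀ n : ℕ, |(m n : ℝ) - κ * n| ≤ C) :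
    Filter.Tendsto (fun n => scaledStirling ω n (m n + 1) / scaledStirling ω n (m n))
      Filter.atTop (nhds 1) := by
  have h0 : 0 < κ * ω := by positivity
  have hr := tendsto_coeff_ratio hκ h0 (by rw [hωeq]) hm
  have hmn : Filter.Tendsto (fun n : ℕ => ((m n : ℝ) + 1) / n) Filter.atTop (nhds κ) := by
    have h1 : Filter.Tendsto (fun n : ℕ => ((m n : ℝ) + 1 - κ * n) / n)
        Filter.atTop (nhds 0) := by
      refine squeeze_zero_norm (a := fun n : ℕ => (C + 1) / n) (fun n => ?_)
        (tendsto_const_div_atTop_nhds_zero_nat _)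
      rw [Real.norm_eq_abs, abs_div, Nat.abs_cast]
      gcongr
      have := abs_le.mp (hm n)
      rw [abs_le]
      constructor <;> linarith [this.1, this.2]
    have h2 := h1.add_const κ
    rw [zero_add] at h2
    refine h2.congr' ?_
    filter_upwards [Filter.eventually_gt_atTop 0] with n hn
    have : (0 : ℝ) < n := by exact_mod_cast hn
    field_simp
    ring
  have hmul := (hmn.mul_const ω).mul (hr.inv₀ h0.ne')
  rw [mul_inv_cancel₀ h0.ne'] at hmul
  refine hmul.congr' ?_
  filter_upwards [eventually_le_natCast (C := C) hκ, Filter.eventually_gt_atTop 0] with n h1 hn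
  have hp := stirlingSecond_pos hn (h1 _ (hm n))
  have hp' := stirlingSecond_pos hn ((h1 _ (hm n)).trans (Nat.le_succ _))
  have hn' : (0 : ℝ) < n := by exact_mod_cast hn
  simp only [scaledStirling, stirling2_eq_stirlingSecond, expSubOnePowCoeff, pow_succ,
    Nat.factorial_succ]
  push_cast
  have hq : (0 : ℝ) < Nat.stirlingSecond (m n) n := by exact_mod_cast hp
  have hq' : (0 : ℝ) < Nat.stirlingSecond (m n + 1) n := by exact_mod_cast hp'
  have hf : (0 : ℝ) < n.factorial := by positivity
  have hg : (0 : ℝ) < (m n).factorial := by positivity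
  field_simp

lemma tendsto_scaledStirling_add {κ C ω : ℝ} (hκ : 1 < κ) (hω : 0 < ω)
    (hωeq : 1 - Real.exp (-(κ * ω)) = ω) {m : ℕ → ℕ} (hm : ∀ n : ℕ, |(m n : ℝ) - κ * n| ≤ C)
    (j : ℕ) :
    Filter.Tendsto (fun n => scaledStirling ω n (m n + j) / scaledStirling ω n (m n))
      Filter.atTop (nhds 1) := by
  have hne : ∀ j, ∀ᶠ n : ℕ in Filter.atTop, scaledStirling ω n (m n + j) ≠ 0 := by
    intro j
    filter_upwards [eventually_le_natCast (C := C) hκ, Filter.eventually_gt_atTop 0] with n h1 hn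
    have hp := stirlingSecond_pos hn ((h1 _ (hm n)).trans (Nat.le_add_right _ j))
    rw [scaledStirling, stirling2_eq_stirlingSecond]
    positivity
  induction j with
  | zero =>
    refine tendsto_const_nhds.congr' ?_
    filter_upwards [hne 0] with n hn
    exact (div_self hn).symm
  | succ j ih =>
    have hmj : ∀ n : ℕ, |((m n + j : ℕ) : ℝ) - κ * n| ≤ C + j := fun n => by
      have := abs_le.mp (hm n)
      have hj : (0 : ℝ) ≤ j := by positivity
      push_cast
      rw [abs_le]
      constructor <;> linarith [this.1, this.2]
    have h := (tendsto_scaledStirling_succ hκ hω hωeq hmj).mul ih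
    rw [one_mul] at h
    refine h.congr' ?_
    filter_upwards [hne j] with n hn
    rw [div_mul_div_cancel₀ hn, add_assoc]

lemma tendsto_scaledStirling_of_le {κ C ω : ℝ} (hκ : 1 < κ) (hω : 0 < ω)
    (hωeq : 1 - Real.exp (-(κ * ω)) = ω) {m m' : ℕ → ℕ}
    (hm : ∀ n : ℕ, |(m n : ℝ) - κ * n| ≤ C) (hm' : ∀ n : ℕ, |(m' n : ℝ) - κ * n| ≤ C)
    (hle : ∀ n, m n ≤ m' n) :
    Filter.Tendsto (fun n => scaledStirling ω n (m' n) / scaledStirling ω n (m n))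
      Filter.atTop (nhds 1) := by
  obtain ⟨J, hJ⟩ := exists_nat_gt (2 * C)
  rw [Filter.tendsto_def]
  intro s hs
  have h : ∀ᶠ n in Filter.atTop, ∀ j ∈ Finset.range J,
      scaledStirling ω n (m n + j) / scaledStirling ω n (m n) ∈ s :=
    (Filter.eventually_all_finset _).mpr fun j _ =>
      (tendsto_scaledStirling_add hκ hω hωeq hm j).eventually hs
  filter_upwards [h] with n hn
  have hlt : m' n - m n < J := by
    have h1 := abs_le.mp (hm n)
    have h2 := abs_le.mp (hm' n)
    have : (m' n : ℝ) < m n + J := by linarith [h1.1, h2.2]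
    have : m' n < m n + J := by exact_mod_cast this
    have := hle n
    omega
  have := hn _ (Finset.mem_range.mpr hlt)
  rwa [Nat.add_sub_cancel' (hle n)] at this

/-- For `κ > 1`, `ω` the unique root in `(0,1)` of
`-κω = ln(1-ω)`, and sequences `M, M'` with `M(n), M'(n) = κn + O(1)`,
`S(M(n), n) / (S(M'(n), n) (n/ω)^{M(n)-M'(n)}) → 1`. -/
theorem statement9 (κ : ℝ) (hκ : 1 < κ)
    (ω : ℝ) (hω : ω ∈ Set.Ioo (0 : ℝ) 1)
    (hωeq : -κ * ω = Real.log (1 - ω))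
    (M M' : ℕ → ℕ) (C : ℝ)
    (hM : ∀ n : ℕ, |(M n : ℝ) - κ * n| ≤ C)
    (hM' : ∀ n : ℕ, |(M' n : ℝ) - κ * n| ≤ C) :
    Filter.Tendsto
      (fun n : ℕ =>
        (stirling2 (M n) n : ℝ) /
          ((stirling2 (M' n) n : ℝ) * ((n : ℝ) / ω) ^ ((M n : ℤ) - (M' n : ℤ))))
      Filter.atTop (nhds 1) := by
  have hω0 := hω.1
  have hω1 : 1 - Real.exp (-(κ * ω)) = ω := by
    rw [← neg_mul, hωeq, Real.exp_log (by linarith [hω.2])]; ring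
  have hL : ∀ n : ℕ, |((min (M n) (M' n) : ℕ) : ℝ) - κ * n| ≤ C := fun n => by
    rcases min_choice (M n) (M' n) with h | h <;> rw [h]
    exacts [hM n, hM' n]
  have h1 := tendsto_scaledStirling_of_le hκ hω0 hω1 hL hM fun n => min_le_left _ _
  have h2 := tendsto_scaledStirling_of_le hκ hω0 hω1 hL hM' fun n => min_le_right _ _
  have h := h1.div h2 one_ne_zero
  rw [div_one] at h
  refine h.congr' ?_
  filter_upwards [eventually_le_natCast (C := C) hκ, Filter.eventually_gt_atTop 0] with n hle hn
  have hp := stirlingSecond_pos hn (hle _ (hL n))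
  have hn' : (n : ℝ) ≠ 0 := by exact_mod_cast hn.ne'
  have hne : scaledStirling ω n (min (M n) (M' n)) ≠ 0 := by
    rw [scaledStirling, stirling2_eq_stirlingSecond]
    positivity
  simp only [Pi.div_apply]
  rw [div_div_div_cancel_right₀ hne, scaledStirling, scaledStirling,
    zpow_sub₀ (by positivity), zpow_natCast, zpow_natCast, ← inv_div (n : ℝ) ω, inv_pow, inv_pow]
  have hx : (n : ℝ) / ω ≠ 0 := by positivity
  field_simp

end ArxivAutomata
end
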